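/- Let ε > 0, t ∈ ℕ, and let G be a (p,λ)-bijumbled graph on n vertices with p ∈ (0,1] and λ ≤ ε p² n. Given nonempty vertex subsets U₁, …, U_t, W ⊆ V(G) such that |W| > Σ_{i=1}^{t} 4 ε² p² n² / |Uᵢ|, there exists a vertex w ∈ W such that |N_G(w) ∩ Uᵢ| ≥ p|Uᵢ|/2 for every i ∈ [t]. -/

import Mathlib

open Finset

/-- The number of pairs `(a,b) ∈ A × B` with `ab` an edge of `G`
(edges inside `A ∩ B` are counted twice). -/
def ePairs {V : Type} [DecidableEq V] (G : SimpleGraph V) [DecidableRel G.Adj]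
    (A B : Finset V) : ℕ :=
  ((A ×ˢ B).filter fun ab => G.Adj ab.1 ab.2).card

/-- `G` is `(p,λ)`-bijumbled: `|e(A,B) − p|A||B|| < λ√(|A||B|)` for all (nonempty)
vertex subsets `A, B`. -/
def Bijumbled {V : Type} [Fintype V] [DecidableEq V] (G : SimpleGraph V)
    [DecidableRel G.Adj] (p lam : ℝ) : Prop :=
  ∀ A B : Finset V, A.Nonempty → B.Nonempty →
    |(ePairs G A B : ℝ) - p * A.card * B.card| < lam * Real.sqrt (A.card * B.card)

/-- `degIn G v U` is the number of neighbours of `v` in `U`, i.e. `|N_G(v) ∩ U|`. -/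
def degIn {V : Type} [DecidableEq V] (G : SimpleGraph V) [DecidableRel G.Adj]
    (v : V) (U : Finset V) : ℕ :=
  (U.filter fun u => G.Adj v u).card

theorem ePairs_eq_sum_degIn {V : Type} [DecidableEq V] (G : SimpleGraph V)
    [DecidableRel G.Adj] (A B : Finset V) : ePairs G A B = ∑ a ∈ A, degIn G a B := by
  simp only [ePairs, degIn, card_filter, sum_product]

/-- In a bijumbled graph, a nonempty set `A` of vertices each having fewer than `p|B|/2`
neighbours in `B` satisfies `p²|A||B| ≤ 4λ²`, and `λ` is positive. -/
theorem Bijumbled.card_mul_card_le {V : Type} [Fintype V] [DecidableEq V]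
    {G : SimpleGraph V} [DecidableRel G.Adj] {p lam : ℝ} (hp : 0 < p)
    (hG : Bijumbled G p lam) {A B : Finset V} (hA : A.Nonempty) (hB : B.Nonempty)
    (hdeg : ∀ a ∈ A, (degIn G a B : ℝ) ≤ p * B.card / 2) :
    0 < lam ∧ p ^ 2 * (A.card * B.card) ≤ 4 * lam ^ 2 := by
  have hcA : (0 : ℝ) < A.card := by exact_mod_cast hA.card_pos
  have hcB : (0 : ℝ) < B.card := by exact_mod_cast hB.card_pos
  have hsum : (ePairs G A B : ℝ) ≤ A.card * (p * B.card / 2) := by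
    rw [ePairs_eq_sum_degIn]
    push_cast
    simpa [nsmul_eq_mul] using sum_le_card_nsmul A _ _ hdeg
  have hjum := neg_lt_of_abs_lt (hG A B hA hB)
  have hs : 0 < Real.sqrt (A.card * B.card) := Real.sqrt_pos.2 (mul_pos hcA hcB)
  have hsq : Real.sqrt (A.card * B.card) ^ 2 = A.card * B.card :=
    Real.sq_sqrt (mul_pos hcA hcB).le
  set s := Real.sqrt (A.card * B.card)
  have hlt : p * s * s < 2 * lam * s := by
    have : p * s * s = p * (A.card * B.card) := by rw [← hsq]; ring
    linarith
  have hlt' : p * s < 2 * lam := lt_of_mul_lt_mul_right hlt hs.le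
  have hps : 0 < p * s := mul_pos hp hs
  refine ⟨by linarith, ?_⟩
  rw [← hsq]
  nlinarith

/-- in a `(p,λ)`-bijumbled graph with `p ∈ (0,1]` and `λ ≤ ε p² n`, given
nonempty sets `U₁,…,U_t` and a set `W` with `|W| > Σᵢ 4 ε² p² n² / |Uᵢ|`, there is a
vertex `w ∈ W` with `|N_G(w) ∩ Uᵢ| ≥ p|Uᵢ|/2` for every `i`. -/
theorem stmt8 {V : Type} [Fintype V] [DecidableEq V] (G : SimpleGraph V)
    [DecidableRel G.Adj] (ε p lam : ℝ) (t : ℕ) (hε : 0 < ε) (hp : 0 < p) (hp1 : p ≤ 1)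
    (hlam : lam ≤ ε * p ^ 2 * Fintype.card V) (hG : Bijumbled G p lam)
    (U : Fin t → Finset V) (W : Finset V) (hUne : ∀ i, (U i).Nonempty)
    (hW : ∑ i, 4 * ε ^ 2 * p ^ 2 * (Fintype.card V : ℝ) ^ 2 / (U i).card
            < (W.card : ℝ)) :
    ∃ w ∈ W, ∀ i, p * (U i).card / 2 ≤ (degIn G w (U i) : ℝ) := by
  by_contra! hcon
  let bad : Fin t → Finset V := fun i =>
    W.filter fun w => (degIn G w (U i) : ℝ) < p * (U i).card / 2
  have hcover : W ⊆ univ.biUnion bad := by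
    intro w hw
    obtain ⟨i, hi⟩ := hcon w hw
    exact mem_biUnion.2 ⟨i, mem_univ i, mem_filter.2 ⟨hw, hi⟩⟩
  have hbad : ∀ i, ((bad i).card : ℝ) ≤
      4 * ε ^ 2 * p ^ 2 * (Fintype.card V : ℝ) ^ 2 / (U i).card := by
    intro i
    have hU : (0 : ℝ) < (U i).card := by exact_mod_cast (hUne i).card_pos
    rcases (bad i).eq_empty_or_nonempty with h | h
    · rw [h, card_empty, Nat.cast_zero]
      positivity
    · obtain ⟨hpos, hle⟩ := hG.card_mul_card_le hp h (hUne i)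
        fun w hw => (mem_filter.1 hw).2.le
      rw [le_div_iff₀ hU]
      have hsq : lam ^ 2 ≤ (ε * p ^ 2 * Fintype.card V) ^ 2 :=
        pow_le_pow_left₀ hpos.le hlam 2
      refine le_of_mul_le_mul_left ?_ (pow_pos hp 2)
      calc p ^ 2 * ((bad i).card * (U i).card) ≤ 4 * lam ^ 2 := hle
        _ ≤ 4 * (ε * p ^ 2 * Fintype.card V) ^ 2 := by gcongr
        _ = _ := by ring
  have hcard : (W.card : ℝ) ≤ ∑ i, ((bad i).card : ℝ) := by
    exact_mod_cast (card_le_card hcover).trans card_biUnion_le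
  exact (hW.trans_le hcard).not_ge (sum_le_sum fun i _ => hbad i)
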